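/- If z is an algebraic number with z ≠ 0 and a is a nonzero algebraic number, then tan(az/2) is transcendental. -/

import Mathlib

section ExpLinearRelations

open Polynomial

theorem isIntegral_pow_mul_aeval {K : Type*} [Field K] {y : ℤ} {x : K}
    (hx : IsIntegral ℤ ((y : K) * x)) {g : ℤ[X]} {N : ℕ} (hg : g.natDegree ≤ N) :
    IsIntegral ℤ ((y : K) ^ N * aeval x g) := by
  rw [aeval_eq_sum_range, Finset.mul_sum]
  refine IsIntegral.sum _ fun i hi => ?_
  have hi' : i ≤ N := (Finset.mem_range_succ_iff.mp hi).trans hg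
  have h : (y : K) ^ N * (g.coeff i • x ^ i) =
      algebraMap ℤ K (g.coeff i * y ^ (N - i)) * ((y : K) * x) ^ i := by
    rw [← Nat.sub_add_cancel hi', pow_add, zsmul_eq_mul, Nat.add_sub_cancel]
    simp only [algebraMap_int_eq, eq_intCast, Int.cast_mul, Int.cast_pow, mul_pow]
    ring
  rw [h]
  exact isIntegral_algebraMap.mul (hx.pow i)

theorem exists_int_eq_of_isIntegral_of_fixed {K : Type*} [Field K] [Algebra ℚ K]
    [FiniteDimensional ℚ K] [IsGalois ℚ K] {x : K} (hx : IsIntegral ℤ x)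
    (hfix : ∀ σ : K ≃ₐ[ℚ] K, σ x = x) : ∃ m : ℤ, (m : K) = x := by
  obtain ⟨q, rfl⟩ := IntermediateField.mem_bot.mp ((IsGalois.mem_bot_iff_fixed x).mpr hfix)
  have hq : IsIntegral ℤ q :=
    (isIntegral_algHom_iff ((algebraMap ℚ K).toIntAlgHom) (algebraMap ℚ K).injective).mp hx
  obtain ⟨m, rfl⟩ := IsIntegrallyClosed.isIntegral_iff.mp hq
  exact ⟨m, by simp⟩

theorem exists_int_polynomial_vanishing_on {K : Type*} [Field K] [Algebra ℚ K]
    [FiniteDimensional ℚ K] (s : Finset K) (hs : 0 ∉ s) :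
    ∃ f : ℤ[X], f.eval 0 ≠ 0 ∧ ∀ x ∈ s, aeval x f = 0 := by
  have h (x : K) : ∃ f : ℤ[X], x ≠ 0 → f.eval 0 ≠ 0 ∧ aeval x f = 0 := by
    by_cases hx : x = 0
    · exact ⟨0, fun h => absurd hx h⟩
    · have halg : IsAlgebraic ℤ x :=
        (IsFractionRing.isAlgebraic_iff ℤ ℚ K).mpr (Algebra.IsAlgebraic.isAlgebraic x)
      obtain ⟨q, hq, hq'⟩ := halg.exists_nonzero_coeff_and_aeval_eq_zero
        (mem_nonZeroDivisors_of_ne_zero hx)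
      exact ⟨q, fun _ => ⟨by rwa [← coeff_zero_eq_eval_zero], hq'⟩⟩
  choose f hf using h
  refine ⟨∏ x ∈ s, f x, ?_, fun x hx => ?_⟩
  · rw [eval_prod]
    exact Finset.prod_ne_zero_iff.mpr fun x hx => (hf x fun h => hs (h ▸ hx)).1
  · rw [map_prod]
    exact Finset.prod_eq_zero hx (hf x fun h => hs (h ▸ hx)).2

theorem exists_prime_gt_mul_pow_div_factorial_lt_one (A B : ℝ) (N : ℕ) :
    ∃ p > N, p.Prime ∧ A * (B ^ p / (p - 1).factorial) < 1 := by
  have h := (FloorSemiring.tendsto_pow_div_factorial_atTop B).const_mul (A * B)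
  rw [mul_zero] at h
  obtain ⟨M, hM⟩ := Filter.eventually_atTop.mp (h.eventually_lt_const one_pos)
  obtain ⟨p, hp, hprime⟩ := Nat.exists_infinite_primes (M + N + 1)
  refine ⟨p, by omega, hprime, ?_⟩
  obtain ⟨k, rfl⟩ := Nat.exists_eq_succ_of_ne_zero hprime.ne_zero
  have := hM k (by omega)
  rw [Nat.succ_sub_one, pow_succ]
  calc A * (B ^ k * B / k.factorial) = A * B * (B ^ k / k.factorial) := by ring
    _ < 1 := this

/-- An integer combination of exponentials that is invariant under the Galois group and has
nonzero constant term does not vanish. -/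
theorem sum_mul_exp_ne_zero {K : Type*} [Field K] [Algebra ℚ K]
    [FiniteDimensional ℚ K] [IsGalois ℚ K] (ι : K →ₐ[ℚ] ℂ) (H : K →₀ ℤ)
    (hinv : ∀ (σ : K ≃ₐ[ℚ] K) (x : K), H (σ x) = H x) (h0 : H 0 ≠ 0) :
    H.sum (fun x m => (m : ℂ) * Complex.exp (ι x)) ≠ 0 := by
  classical
  intro hsum
  have : CharZero K := algebraRat.charZero K
  set S := H.support.erase 0 with hS
  have h0S : (0 : K) ∈ H.support := Finsupp.mem_support_iff.mpr h0
  rw [Finsupp.sum, ← Finset.add_sum_erase _ _ h0S, map_zero ι, Complex.exp_zero, mul_one] at hsum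
  obtain ⟨f, hf0, hf⟩ := exists_int_polynomial_vanishing_on S (Finset.notMem_erase 0 _)
  obtain ⟨y, hy0, hy⟩ := exists_integral_multiples ℤ ℚ S
  obtain ⟨c, hc⟩ := LindemannWeierstrass.exp_polynomial_approx f hf0
  set d := f.natDegree
  obtain ⟨p, hpN, hp, hlt⟩ := exists_prime_gt_mul_pow_div_factorial_lt_one
    (∑ x ∈ S, ‖(H x : ℂ)‖) (‖(y : ℂ)‖ ^ d * c)
    (max (f.eval 0).natAbs (max y.natAbs (H 0).natAbs))
  obtain ⟨n, hpn, g, hg, happ⟩ := hc p (by omega) hp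
  have hint : IsIntegral ℤ (∑ x ∈ S, (H x : K) * ((y : K) ^ (p * d) * aeval x g)) := by
    refine IsIntegral.sum _ fun x hx => IsIntegral.mul ?_ ?_
    · exact isIntegral_algebraMap (R := ℤ) (x := H x)
    · exact isIntegral_pow_mul_aeval (by simpa using hy x hx) (by omega)
  have hmem (σ : K ≃ₐ[ℚ] K) (x : K) : x ∈ S ↔ σ x ∈ S := by
    simp [hS, hinv]
  obtain ⟨M, hM⟩ := exists_int_eq_of_isIntegral_of_fixed hint fun σ => by
    rw [map_sum]
    refine Finset.sum_equiv σ.toEquiv (hmem σ) fun x _ => ?_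
    have : σ (aeval x g) = aeval (σ x) g :=
      (aeval_algHom_apply (σ : K →+* K).toIntAlgHom x g).symm
    simp [hinv, this]
  have hdvd : ¬ (p : ℤ) ∣ y ^ (p * d) * (n * H 0) + p * M := by
    have hpp := Nat.prime_iff_prime_int.mp hp
    have hsmall (z : ℤ) (hz : z ≠ 0) (hzp : z.natAbs < p) : ¬ (p : ℤ) ∣ z := fun h =>
      absurd (Nat.le_of_dvd (Int.natAbs_pos.mpr hz) (Int.natCast_dvd.mp h)) (by omega)
    rw [dvd_add_left (dvd_mul_right _ _)]
    intro h
    rcases hpp.dvd_or_dvd h with h | h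
    · exact hsmall y hy0 (by omega) (hpp.dvd_of_dvd_pow h)
    · rcases hpp.dvd_or_dvd h with h | h
      · exact hpn h
      · exact hsmall _ h0 (by omega) h
  have hone : (1 : ℝ) ≤ ‖((y ^ (p * d) * (n * H 0) + p * M : ℤ) : ℂ)‖ := by
    rw [Complex.norm_intCast]
    have hne : y ^ (p * d) * (n * H 0) + p * M ≠ 0 := fun h => hdvd (by rw [h]; exact dvd_zero _)
    exact_mod_cast Int.one_le_abs hne
  have hMC : (M : ℂ) = ∑ x ∈ S, (H x : ℂ) * ((y : ℂ) ^ (p * d) * aeval (ι x) g) := by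
    have := congrArg ι hM
    rw [map_intCast, map_sum] at this
    rw [this]
    refine Finset.sum_congr rfl fun x _ => ?_
    have : ι (aeval x g) = aeval (ι x) g :=
      (aeval_algHom_apply (ι : K →+* ℂ).toIntAlgHom x g).symm
    simp [this]
  have heq : ((y ^ (p * d) * (n * H 0) + p * M : ℤ) : ℂ) =
      -((y : ℂ) ^ (p * d) * ∑ x ∈ S, (H x : ℂ) *
        (n • Complex.exp (ι x) - p • aeval (ι x) g)) := by
    have h1 : ∑ x ∈ S, (H x : ℂ) * (n • Complex.exp (ι x) - p • aeval (ι x) g) =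
        n * ∑ x ∈ S, (H x : ℂ) * Complex.exp (ι x) - p * ∑ x ∈ S, (H x : ℂ) * aeval (ι x) g := by
      rw [Finset.mul_sum, Finset.mul_sum, ← Finset.sum_sub_distrib]
      refine Finset.sum_congr rfl fun x _ => ?_
      simp only [zsmul_eq_mul, nsmul_eq_mul]
      ring
    have h2 : (M : ℂ) = (y : ℂ) ^ (p * d) * ∑ x ∈ S, (H x : ℂ) * aeval (ι x) g := by
      rw [hMC, Finset.mul_sum]
      exact Finset.sum_congr rfl fun x _ => by ring
    rw [h1]
    push_cast
    rw [h2]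
    linear_combination (y : ℂ) ^ (p * d) * n * hsum
  have hle : ‖((y ^ (p * d) * (n * H 0) + p * M : ℤ) : ℂ)‖ ≤
      (∑ x ∈ S, ‖(H x : ℂ)‖) * ((‖(y : ℂ)‖ ^ d * c) ^ p / (p - 1).factorial) := by
    rw [heq, norm_neg, norm_mul, norm_pow]
    calc ‖(y : ℂ)‖ ^ (p * d) * ‖∑ x ∈ S, (H x : ℂ) *
          (n • Complex.exp (ι x) - p • aeval (ι x) g)‖
        ≤ ‖(y : ℂ)‖ ^ (p * d) * ∑ x ∈ S, ‖(H x : ℂ)‖ * (c ^ p / (p - 1).factorial) := by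
          gcongr
          refine norm_sum_le_of_le _ fun x hx => ?_
          rw [norm_mul]
          gcongr
          refine happ ((mem_aroots).mpr ⟨fun h => hf0 (by simp [h]), ?_⟩)
          have : ι (aeval x f) = aeval (ι x) f :=
            (aeval_algHom_apply (ι : K →+* ℂ).toIntAlgHom x f).symm
          rw [← this, hf x hx, map_zero]
      _ = _ := by
          rw [← Finset.sum_mul, mul_pow, ← pow_mul, mul_comm d p]
          ring
  linarith

end ExpLinearRelations

section HermiteLindemann

open Polynomial AddMonoidAlgebra

/-- The ring homomorphism from formal to actual integer combinations of exponentials. -/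
noncomputable def expEval {K : Type*} [Field K] (ι : K →+* ℂ) :
    AddMonoidAlgebra ℤ K →ₐ[ℤ] ℂ :=
  AddMonoidAlgebra.lift ℤ ℂ K
    { toFun := fun x => Complex.exp (ι x.toAdd)
      map_one' := by simp
      map_mul' := fun x y => by simp [Complex.exp_add] }

theorem expEval_apply {K : Type*} [Field K] (ι : K →+* ℂ) (F : AddMonoidAlgebra ℤ K) :
    expEval ι F = F.coeff.sum fun x m => (m : ℂ) * Complex.exp (ι x) := by
  simp [expEval, AddMonoidAlgebra.lift_apply]

theorem expEval_single {K : Type*} [Field K] (ι : K →+* ℂ) (x : K) :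
    expEval ι (single x 1) = Complex.exp (ι x) := by
  simp [expEval]

theorem aeval_single_ne_zero {K : Type*} [Field K] [CharZero K] {x : K} (hx : x ≠ 0)
    {B : ℤ[X]} (hB : B ≠ 0) : aeval (single x 1 : AddMonoidAlgebra ℤ K) B ≠ 0 := by
  classical
  intro h
  have hinj (i : ℕ) : i • x = B.natDegree • x ↔ i = B.natDegree := by
    simp [hx]
  have hcoeff := congrArg (fun F => AddMonoidAlgebra.coeff F (B.natDegree • x)) h
  simp only [aeval_eq_sum_range, single_pow, one_pow, AddMonoidAlgebra.coeff_sum,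
    AddMonoidAlgebra.coeff_smul, Finsupp.finsetSum_apply, Finsupp.smul_apply,
    AddMonoidAlgebra.coeff_single, Finsupp.single_apply, AddMonoidAlgebra.coeff_zero,
    Finsupp.coe_zero, Pi.zero_apply, hinj] at hcoeff
  simp [hB] at hcoeff

/-- A nonzero Galois-invariant formal combination of exponentials has nonzero value. -/
theorem expEval_ne_zero_of_invariant {K : Type*} [Field K] [Algebra ℚ K]
    [FiniteDimensional ℚ K] [IsGalois ℚ K] (ι : K →ₐ[ℚ] ℂ) {F : AddMonoidAlgebra ℤ K}
    (hF : F ≠ 0)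
    (hinv : ∀ σ : K ≃ₐ[ℚ] K, AddMonoidAlgebra.domCongr ℤ ℤ (σ : K ≃+ K) F = F) :
    expEval (ι : K →+* ℂ) F ≠ 0 := by
  classical
  intro h
  obtain ⟨x, hx⟩ : ∃ x, F.coeff x ≠ 0 := by
    by_contra! hcon
    exact hF (AddMonoidAlgebra.ext (Finsupp.ext hcon))
  have hcoeff (σ : K ≃ₐ[ℚ] K) (y : K) : F.coeff (σ y) = F.coeff y := by
    conv_lhs => rw [← hinv σ, coeff_domCongr]
    simp
  set T : AddMonoidAlgebra ℤ K := ∑ τ : K ≃ₐ[ℚ] K, single (-(τ x)) 1 with hT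
  have hTinv (σ : K ≃ₐ[ℚ] K) : AddMonoidAlgebra.domCongr ℤ ℤ (σ : K ≃+ K) T = T := by
    rw [hT, map_sum]
    refine Fintype.sum_equiv (Equiv.mulLeft σ) _ _ fun τ => ?_
    rw [domCongr_single]
    simp only [map_neg]
    rfl
  have hH : expEval (ι : K →+* ℂ) (F * T) = 0 := by rw [map_mul, h, zero_mul]
  rw [expEval_apply] at hH
  refine sum_mul_exp_ne_zero ι (F * T).coeff (fun σ y => ?_) ?_ hH
  · have : AddMonoidAlgebra.domCongr ℤ ℤ (σ : K ≃+ K) (F * T) = F * T := by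
      rw [map_mul, hinv, hTinv]
    conv_lhs => rw [← this, coeff_domCongr]
    simp
  · have hτ (τ : K ≃ₐ[ℚ] K) : (F * single (-(τ x)) 1).coeff 0 = F.coeff x := by
      rw [← hcoeff τ x]
      simp
    rw [hT, Finset.mul_sum, AddMonoidAlgebra.coeff_sum, Finsupp.finsetSum_apply,
      Finset.sum_congr rfl fun τ _ => hτ τ]
    simp [hx]

theorem aeval_exp_ne_zero {K : Type*} [Field K] [Algebra ℚ K] [FiniteDimensional ℚ K]
    [IsGalois ℚ K] (ι : K →ₐ[ℚ] ℂ) {u : K} (hu : u ≠ 0) {B : ℤ[X]} (hB : B ≠ 0) :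
    aeval (Complex.exp (ι u)) B ≠ 0 := by
  intro h
  have : CharZero K := algebraRat.charZero K
  let P : AddMonoidAlgebra ℤ K := aeval (single u 1) B
  let F : AddMonoidAlgebra ℤ K :=
    ∏ σ : K ≃ₐ[ℚ] K, AddMonoidAlgebra.domCongr ℤ ℤ (σ : K ≃+ K) P
  have hP : P ≠ 0 := aeval_single_ne_zero hu hB
  have hF : F ≠ 0 := Finset.prod_ne_zero_iff.mpr fun σ _ =>
    (map_ne_zero_iff _ (AlgEquiv.injective _)).mpr hP
  refine expEval_ne_zero_of_invariant ι hF (fun σ => ?_) ?_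
  · rw [map_prod]
    refine Fintype.prod_equiv (Equiv.mulLeft σ) _ _ fun τ => ?_
    rw [← AlgEquiv.trans_apply, trans_domCongr_domCongr]
    rfl
  · rw [map_prod]
    refine Finset.prod_eq_zero (Finset.mem_univ 1) ?_
    have h1 : AddMonoidAlgebra.domCongr ℤ ℤ ((1 : K ≃ₐ[ℚ] K) : K ≃+ K) P = P :=
      DFunLike.congr_fun domCongr_refl P
    rw [h1, ← aeval_algHom_apply, expEval_single]
    exact h

/-- The **Hermite–Lindemann theorem**. -/
theorem transcendental_exp {w : ℂ} (hw : IsAlgebraic ℚ w) (hw0 : w ≠ 0) :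
    Transcendental ℚ (Complex.exp w) := by
  intro halg
  obtain ⟨B, hB0, hB⟩ := (IsFractionRing.isAlgebraic_iff ℤ ℚ ℂ).mpr halg
  let K := IntermediateField.adjoin ℚ ((minpoly ℚ w).rootSet ℂ)
  have : (minpoly ℚ w).IsSplittingField ℚ K :=
    IntermediateField.adjoin_rootSet_isSplittingField (IsAlgClosed.splits _)
  have : FiniteDimensional ℚ K := IsSplittingField.finiteDimensional K (minpoly ℚ w)
  have : IsGalois ℚ K :=
    IsGalois.of_separable_splitting_field (minpoly.irreducible hw.isIntegral).separable
  have hwK : w ∈ K := IntermediateField.subset_adjoin _ _ <|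
    mem_rootSet.mpr ⟨minpoly.ne_zero hw.isIntegral, minpoly.aeval ℚ w⟩
  have hu : (⟨w, hwK⟩ : K) ≠ 0 := fun h => hw0 (congrArg Subtype.val h)
  exact @aeval_exp_ne_zero K _ _ _ this K.val _ hu B hB0 hB

end HermiteLindemann

/-- If `tan w` is algebraic then so is `exp (2 i w)`. -/
theorem isAlgebraic_exp_of_isAlgebraic_tan {w : ℂ} (h : IsAlgebraic ℚ (Complex.tan w)) :
    IsAlgebraic ℚ (Complex.exp (2 * (w * Complex.I))) := by
  have hI : IsAlgebraic ℚ Complex.I := by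
    refine IsAlgebraic.of_pow two_pos ?_
    rw [Complex.I_sq]
    exact isAlgebraic_one.neg
  have hexp : Complex.exp (2 * (w * Complex.I)) =
      (Complex.cos w + Complex.sin w * Complex.I) ^ 2 := by
    rw [← Complex.exp_mul_I, ← Complex.exp_nat_mul]
    norm_num
  have hsq := Complex.sin_sq_add_cos_sq w
  by_cases hc : Complex.cos w = 0
  · rw [hc] at hsq
    have : Complex.exp (2 * (w * Complex.I)) = -1 := by
      rw [hexp, hc]
      linear_combination Complex.sin w ^ 2 * Complex.I_sq - hsq
    rw [this]
    exact isAlgebraic_one.neg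
  · have hs : Complex.sin w = Complex.tan w * Complex.cos w := (Complex.tan_mul_cos hc).symm
    rw [hs] at hsq hexp
    have hprod : Complex.cos w ^ 2 * (1 + Complex.tan w * Complex.I) *
        (1 - Complex.tan w * Complex.I) = 1 := by
      linear_combination hsq - Complex.cos w ^ 2 * Complex.tan w ^ 2 * Complex.I_sq
    have hne : 1 - Complex.tan w * Complex.I ≠ 0 := right_ne_zero_of_mul_eq_one hprod
    have : Complex.exp (2 * (w * Complex.I)) =
        (1 + Complex.tan w * Complex.I) * (1 - Complex.tan w * Complex.I)⁻¹ := by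
      rw [hexp, eq_mul_inv_iff_mul_eq₀ hne]
      linear_combination (1 + Complex.tan w * Complex.I) * hprod
    rw [this]
    exact (isAlgebraic_one.add (h.mul hI)).mul (isAlgebraic_one.sub (h.mul hI)).inv

/-- If `z` and `a` are nonzero algebraic numbers then `tan (a z / 2)` is
transcendental. -/
theorem stmt5 (z a : ℂ) (hz : IsAlgebraic ℚ z) (hz0 : z ≠ 0)
    (ha : IsAlgebraic ℚ a) (ha0 : a ≠ 0) :
    Transcendental ℚ (Complex.tan (a * z / 2)) := by
  intro h
  have hI : IsAlgebraic ℚ Complex.I := by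
    refine IsAlgebraic.of_pow two_pos ?_
    rw [Complex.I_sq]
    exact isAlgebraic_one.neg
  have h2 : 2 * (a * z / 2 * Complex.I) = a * z * Complex.I := by ring
  have halg := isAlgebraic_exp_of_isAlgebraic_tan h
  rw [h2] at halg
  exact transcendental_exp ((ha.mul hz).mul hI)
    (mul_ne_zero (mul_ne_zero ha0 hz0) Complex.I_ne_zero) halg
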